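/- Let z M : ℤ with z ≥ 0 and M ≥ 1. If there exist x y : ℤ with x^2 + z*x*y + y^2 = M, then there exist x y : ℤ with 0 ≤ x, 0 ≤ y and x^2 + z*x*y + y^2 = M. Moreover, for every a b : ℤ with a^2 + z*a*b + b^2 = M there is exactly one unit ε of R_z := AdjoinRoot (X^2 - C z * X + 1 : ℤ[X]) such that ε • (a + b•ω) = x + y•ω for some x y : ℤ with x > 0 and y ≥ 0. -/

import Mathlib

open Polynomial

noncomputable abbrev Rz (z : ℤ) : Type :=
  AdjoinRoot (X ^ 2 - C z * X + 1 : ℤ[X])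

noncomputable abbrev omegaZ (z : ℤ) : Rz z :=
  AdjoinRoot.root (X ^ 2 - C z * X + 1 : ℤ[X])

namespace Rz

theorem omega_sq (z : ℤ) : omegaZ z ^ 2 = z * omegaZ z - 1 := by
  have h := AdjoinRoot.eval₂_root (X ^ 2 - C z * X + 1 : ℤ[X])
  simp only [eval₂_add, eval₂_sub, eval₂_mul, eval₂_X_pow, eval₂_C, eval₂_X, eval₂_one]
    at h
  rw [eq_intCast (AdjoinRoot.of _)] at h
  linear_combination h

theorem mul_formula (z c d a b : ℤ) :
    ((c : Rz z) + d • omegaZ z) * ((a : Rz z) + b • omegaZ z) =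
      ((a * c - b * d : ℤ) : Rz z) + (a * d + b * c + z * b * d : ℤ) • omegaZ z := by
  simp only [zsmul_eq_mul]
  push_cast
  linear_combination (d * b : Rz z) * omega_sq z

theorem exists_coords (z : ℤ) (t : Rz z) : ∃ a b : ℤ, t = (a : Rz z) + b • omegaZ z := by
  obtain ⟨p, rfl⟩ := AdjoinRoot.mk_surjective t
  induction p using Polynomial.induction_on with
  | C n => exact ⟨n, 0, by simp⟩
  | add p q hp hq =>
    obtain ⟨a, b, h⟩ := hp
    obtain ⟨c, d, h'⟩ := hq
    refine ⟨a + c, b + d, ?_⟩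
    rw [map_add, h, h']
    simp only [zsmul_eq_mul]
    push_cast
    ring
  | monomial n k h =>
    obtain ⟨a, b, h⟩ := h
    refine ⟨-b, a + z * b, ?_⟩
    have h1 := mul_formula z 0 1 a b
    rw [pow_succ (X : ℤ[X]) n, ← mul_assoc, map_mul, h, AdjoinRoot.mk_X, mul_comm]
    simpa [-mul_eq_mul_left_iff, mul_add] using h1

theorem coords_injective {z a b c d : ℤ}
    (h : (a : Rz z) + b • omegaZ z = (c : Rz z) + d • omegaZ z) : a = c ∧ b = d := by
  have hmon : (X ^ 2 - C z * X + 1 : ℤ[X]).Monic := by monicity!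
  have hdeg : (X ^ 2 - C z * X + 1 : ℤ[X]).natDegree = 2 := by compute_degree!
  have h0 : AdjoinRoot.mk (X ^ 2 - C z * X + 1 : ℤ[X]) (C (b - d) * X + C (a - c)) = 0 := by
    simp only [map_add, map_mul, AdjoinRoot.mk_X, AdjoinRoot.mk_C]
    rw [eq_intCast (AdjoinRoot.of _), eq_intCast (AdjoinRoot.of _)]
    simp only [zsmul_eq_mul] at h
    push_cast
    linear_combination h
  rw [AdjoinRoot.mk_eq_zero] at h0
  have h1 := eq_zero_of_dvd_of_natDegree_lt h0
    (by rw [hdeg]; exact natDegree_linear_le.trans_lt one_lt_two)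
  have e0 := congrArg (fun p => coeff p 0) h1
  have e1 := congrArg (fun p => coeff p 1) h1
  simp [-eq_intCast, -map_sub, coeff_C] at e0 e1
  constructor <;> linarith

theorem norm_unit {z c d : ℤ} {ε : (Rz z)ˣ} (h : (ε : Rz z) = (c : Rz z) + d • omegaZ z) :
    IsUnit (c ^ 2 + z * c * d + d ^ 2) := by
  obtain ⟨e, f, h'⟩ := exists_coords z (ε⁻¹ : (Rz z)ˣ)
  have h1 := ε.mul_inv
  rw [h, h', mul_formula] at h1
  obtain ⟨h2, h3⟩ := coords_injective (c := 1) (d := 0) (h1.trans (by simp))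
  refine IsUnit.of_mul_eq_one (e ^ 2 + z * e * f + f ^ 2) ?_
  have : (e * c - f * d) ^ 2 + z * (e * c - f * d) * (e * d + f * c + z * f * d)
      + (e * d + f * c + z * f * d) ^ 2 = 1 := by rw [h2, h3]; ring
  linear_combination this

/-- Multiplication by the root, as a unit. -/
noncomputable def omegaUnit (z : ℤ) : (Rz z)ˣ where
  val := omegaZ z
  inv := z - omegaZ z
  val_inv := by linear_combination -omega_sq z
  inv_val := by linear_combination -omega_sq z

theorem omegaUnit_smul (z a b : ℤ) :
    omegaUnit z • ((a : Rz z) + b • omegaZ z) =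
      ((-b : ℤ) : Rz z) + (a + z * b : ℤ) • omegaZ z := by
  have := mul_formula z 0 1 a b
  simpa [Units.smul_def, omegaUnit, mul_add] using this

theorem omegaUnit_inv_smul (z a b : ℤ) :
    (omegaUnit z)⁻¹ • ((a : Rz z) + b • omegaZ z) =
      ((a * z + b : ℤ) : Rz z) + (-a : ℤ) • omegaZ z := by
  rw [inv_smul_eq_iff, omegaUnit_smul]
  congr 2 <;> ring_nf

theorem neg_one_smul_coords (z a b : ℤ) :
    (-1 : (Rz z)ˣ) • ((a : Rz z) + b • omegaZ z) =
      ((-a : ℤ) : Rz z) + (-b : ℤ) • omegaZ z := by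
  simp only [Units.smul_def, Units.val_neg, Units.val_one, smul_eq_mul, zsmul_eq_mul]
  push_cast
  ring

/-- Some associate of `a + b • ω` by a unit has coordinates in the half-open positive quadrant
and the same norm. -/
def HasPositiveAssociate (z a b : ℤ) : Prop :=
  ∃ ε : (Rz z)ˣ, ∃ x y : ℤ, 0 < x ∧ 0 ≤ y ∧
    x ^ 2 + z * x * y + y ^ 2 = a ^ 2 + z * a * b + b ^ 2 ∧
    ε • ((a : Rz z) + b • omegaZ z) = (x : Rz z) + y • omegaZ z

namespace HasPositiveAssociate

theorem of_pos {z a b : ℤ} (ha : 0 < a) (hb : 0 ≤ b) : HasPositiveAssociate z a b :=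
  ⟨1, a, b, ha, hb, rfl, one_smul _ _⟩

theorem of_smul {z a b a' b' : ℤ} (δ : (Rz z)ˣ)
    (h : δ • ((a : Rz z) + b • omegaZ z) = (a' : Rz z) + b' • omegaZ z)
    (hN : a' ^ 2 + z * a' * b' + b' ^ 2 = a ^ 2 + z * a * b + b ^ 2)
    (h' : HasPositiveAssociate z a' b') : HasPositiveAssociate z a b := by
  obtain ⟨ε, x, y, hx, hy, hn, he⟩ := h'
  exact ⟨ε * δ, x, y, hx, hy, hn.trans hN, by rw [mul_smul, h, he]⟩

theorem of_omega {z a b : ℤ} (h : HasPositiveAssociate z (-b) (a + z * b)) :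
    HasPositiveAssociate z a b :=
  of_smul _ (omegaUnit_smul z a b) (by ring) h

theorem of_omega_inv {z a b : ℤ} (h : HasPositiveAssociate z (a * z + b) (-a)) :
    HasPositiveAssociate z a b :=
  of_smul _ (omegaUnit_inv_smul z a b) (by ring) h

theorem of_neg {z a b : ℤ} (h : HasPositiveAssociate z (-a) (-b)) :
    HasPositiveAssociate z a b :=
  of_smul _ (neg_one_smul_coords z a b) (by ring) h

theorem of_nonneg {z a b : ℤ} (ha : 0 ≤ a) (hb : 0 ≤ b) (hN : 0 < a ^ 2 + z * a * b + b ^ 2) :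
    HasPositiveAssociate z a b := by
  rcases ha.lt_or_eq with ha | rfl
  · exact of_pos ha hb
  · refine of_omega_inv (of_pos ?_ (by simp))
    have : b ≠ 0 := by rintro rfl; simp at hN
    have : 0 < b := by omega
    simpa

theorem of_pos_neg {z : ℤ} (k : ℕ) : ∀ a n : ℤ, 0 < a → 0 < n → a + n ≤ k →
    0 < a ^ 2 - z * a * n + n ^ 2 → HasPositiveAssociate z a (-n) := by
  induction k with
  | zero => intro a n ha hn h; push_cast at h; omega
  | succ k ih =>
    intro a n ha hn hk hN
    push_cast at hk
    rcases le_or_gt (z * n) a with h1 | h1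
    · exact of_omega (of_pos (by simpa) (by linarith))
    rcases le_or_gt (a * z) n with h2 | h2
    · exact of_omega_inv (of_neg (of_nonneg (by linarith) (by linarith) (by nlinarith)))
    rcases le_or_gt n a with h | h
    · have h3 : z * n - a < n := by
        by_contra! h3
        nlinarith [mul_le_mul_of_nonneg_left h3 ha.le, mul_le_mul_of_nonneg_right h hn.le]
      have := ih n (z * n - a) hn (by linarith) (by linarith) (by nlinarith)
      refine of_omega ?_
      convert this using 1 <;> ring
    · have h3 : a * z - n < a := by
        by_contra! h3
        nlinarith [mul_le_mul_of_nonneg_left h3 hn.le, mul_le_mul_of_nonneg_right h.le ha.le]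
      have := ih (a * z - n) a (by linarith) ha (by linarith) (by nlinarith)
      exact of_omega_inv this

theorem of_norm_pos {z a b : ℤ} (hN : 0 < a ^ 2 + z * a * b + b ^ 2) :
    HasPositiveAssociate z a b := by
  have key : ∀ a n : ℤ, 0 < a → 0 < n → 0 < a ^ 2 - z * a * n + n ^ 2 →
      HasPositiveAssociate z a (-n) := fun a n ha hn h =>
    of_pos_neg (a + n).toNat a n ha hn (Int.self_le_toNat _) h
  rcases le_or_gt 0 a with ha | ha <;> rcases le_or_gt 0 b with hb | hb
  · exact of_nonneg ha hb hN
  · rcases ha.lt_or_eq with ha | rfl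
    · simpa using key a (-b) ha (by linarith) (by linarith)
    · exact of_neg (of_nonneg (by simp) (by linarith) (by linarith))
  · rcases hb.lt_or_eq with hb | rfl
    · exact of_neg (key (-a) b (by linarith) hb (by linarith))
    · exact of_neg (of_nonneg (by linarith) (by simp) (by linarith))
  · exact of_neg (of_nonneg (by linarith) (by linarith) (by linarith))

end HasPositiveAssociate

theorem coords_eq_one {z c d x y : ℤ} (hz : 0 ≤ z) (hN : c ^ 2 + z * c * d + d ^ 2 = 1)
    (hx : 0 < x) (hy : 0 ≤ y) (h1 : 0 < x * c - y * d) (h2 : 0 ≤ x * d + y * c + z * y * d) :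
    c = 1 ∧ d = 0 := by
  rcases lt_trichotomy c 0 with hc | rfl | hc <;> rcases lt_trichotomy d 0 with hd | rfl | hd
  · nlinarith [mul_nonneg hz (mul_pos_of_neg_of_neg hc hd).le]
  · nlinarith
  · nlinarith [mul_nonneg hy hd.le]
  · nlinarith [mul_nonneg hz hy, mul_nonneg (mul_nonneg hz hy) (neg_nonneg.2 hd.le)]
  · simp at hN
  · nlinarith [mul_nonneg hy hd.le]
  · have h3 : c * (c + z * d) ≤ 0 := by nlinarith
    have h4 : c + z * d ≤ 0 := by
      by_contra! h
      nlinarith [mul_pos hc h]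
    nlinarith [mul_nonneg hy (neg_nonneg.2 h4)]
  · exact ⟨by nlinarith, rfl⟩
  · nlinarith [mul_nonneg hz (mul_pos hc hd).le]

theorem unit_eq_one {z : ℤ} (hz : 0 ≤ z) {ε : (Rz z)ˣ} {x y x' y' : ℤ} (hx : 0 < x) (hy : 0 ≤ y)
    (hx' : 0 < x') (hy' : 0 ≤ y')
    (h : ε • ((x : Rz z) + y • omegaZ z) = (x' : Rz z) + y' • omegaZ z) : ε = 1 := by
  obtain ⟨c, d, hε⟩ := exists_coords z ε
  rw [Units.smul_def, smul_eq_mul, hε, mul_formula] at h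
  obtain ⟨h1, h2⟩ := coords_injective h
  have hN : c ^ 2 + z * c * d + d ^ 2 = 1 := by
    rcases Int.isUnit_iff.1 (norm_unit hε) with hN | hN
    · exact hN
    · have hm : (c ^ 2 + z * c * d + d ^ 2) * (x ^ 2 + z * x * y + y ^ 2) =
          x' ^ 2 + z * x' * y' + y' ^ 2 := by rw [← h1, ← h2]; ring
      have : 0 < x ^ 2 + z * x * y + y ^ 2 := by positivity
      have : 0 < x' ^ 2 + z * x' * y' + y' ^ 2 := by positivity
      rw [hN] at hm
      linarith
  obtain ⟨rfl, rfl⟩ := coords_eq_one hz hN hx hy (h1 ▸ hx') (h2 ▸ hy')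
  exact Units.ext (by simpa using hε)

end Rz

theorem stmt5 (z M : ℤ) (hz : 0 ≤ z) (hM : 1 ≤ M) :
    ((∃ x y : ℤ, x ^ 2 + z * x * y + y ^ 2 = M) →
      ∃ x y : ℤ, 0 ≤ x ∧ 0 ≤ y ∧ x ^ 2 + z * x * y + y ^ 2 = M) ∧
    (∀ a b : ℤ, a ^ 2 + z * a * b + b ^ 2 = M →
      ∃! ε : (Rz z)ˣ, ∃ x y : ℤ, 0 < x ∧ 0 ≤ y ∧
        ε • ((a : Rz z) + b • omegaZ z) = (x : Rz z) + y • omegaZ z) := by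
  constructor
  · rintro ⟨a, b, h⟩
    obtain ⟨-, x, y, hx, hy, hN, -⟩ :=
      Rz.HasPositiveAssociate.of_norm_pos (z := z) (a := a) (b := b) (by linarith)
    exact ⟨x, y, hx.le, hy, hN.trans h⟩
  · intro a b h
    obtain ⟨ε, x, y, hx, hy, -, he⟩ :=
      Rz.HasPositiveAssociate.of_norm_pos (z := z) (a := a) (b := b) (by linarith)
    refine ⟨ε, ⟨x, y, hx, hy, he⟩, ?_⟩
    rintro δ ⟨x', y', hx', hy', hd⟩
    rw [← mul_inv_eq_one]
    refine Rz.unit_eq_one hz hx hy hx' hy' ?_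
    rw [← he, mul_smul, inv_smul_smul, hd]
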